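/- arXiv:1609.01635 — 2 statements merged into one kernel-verified Lean document; each statement's English description precedes it below -/
import Mathlib

section
/- Let n ≥ 2. For every X ∈ SO(2n,ℂ) one has a_{-n,…,-3,1,2}(X) · (a_{-n,…,-3,-2}(X))² = −(a_{-n,…,-3,1}(X))² · a_{-n,…,-3,-2,-1}(X), where a_{-n,…,-3,1,2} and a_{-n,…,-3,-2,-1} are n×n minors over the top n rows (rows -n,…,-1) with column sets {-n,…,-3,1,2} and {-n,…,-3,-2,-1}, and a_{-n,…,-3,-2} and a_{-n,…,-3,1} are (n−1)×(n−1) minors over the top n−1 rows (rows -n,…,-2) with column sets {-n,…,-3,-2} and {-n,…,-3,1}. -/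
open Matrix

noncomputable section

/-- The matrix `S` with `S_{k,-k} = 1` and all other entries `0`; rows and
columns are indexed by the ordered set `I_n = {-n,…,-1,1,…,n}` via positions
`0,…,2n-1`, and `-k` corresponds to position reversal `Fin.rev`. -/
def SmatE (n : ℕ) : Matrix (Fin (2*n)) (Fin (2*n)) ℂ :=
  Matrix.of fun p q => if q = p.rev then 1 else 0

/-- The complex even orthogonal group `O(2n,ℂ) = {X : Xᵀ S X = S}`. -/
def Oeven (n : ℕ) : Set (Matrix (Fin (2*n)) (Fin (2*n)) ℂ) :=
  {X | Xᵀ * SmatE n * X = SmatE n}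

/-- The special orthogonal group `SO(2n,ℂ) = {X ∈ O(2n,ℂ) : det X = 1}`. -/
def SOeven (n : ℕ) : Set (Matrix (Fin (2*n)) (Fin (2*n)) ℂ) :=
  {X | X ∈ Oeven n ∧ X.det = 1}

/-- The determinant of `M` with columns `p` and `q` replaced by `b` and `d`. -/
def detTwoCol {ι : Type*} [Fintype ι] [DecidableEq ι] (M : Matrix ι ι ℂ) (p q : ι)
    (b d : ι → ℂ) : ℂ :=
  ((M.updateCol p b).updateCol q d).det

section detTwoCol

variable {ι : Type*} [Fintype ι] [DecidableEq ι] (M : Matrix ι ι ℂ) {p q : ι}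

theorem exists_linearMap_eq_detTwoCol (b : ι → ℂ) :
    ∃ f : (ι → ℂ) →ₗ[ℂ] ℂ, ∀ d, f d = detTwoCol M p q b d :=
  ⟨LinearMap.proj q ∘ₗ cramer (M.updateCol p b), fun d => by simp [detTwoCol, cramer_apply]⟩

theorem detTwoCol_self (hpq : p ≠ q) (b : ι → ℂ) : detTwoCol M p q b b = 0 :=
  det_zero_of_column_eq hpq fun i => by simp [hpq]

theorem detTwoCol_col_right {j : ι} (hp : j ≠ p) (hq : j ≠ q) (b : ι → ℂ) :
    detTwoCol M p q b (M.col j) = 0 :=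
  det_zero_of_column_eq hq fun i => by simp [hp, hq]

theorem detTwoCol_swap (hpq : p ≠ q) (b d : ι → ℂ) :
    detTwoCol M p q d b = -detTwoCol M p q b d := by
  have h := det_permute' (Equiv.swap p q) ((M.updateCol p b).updateCol q d)
  rw [Equiv.Perm.sign_swap hpq] at h
  simp only [detTwoCol]
  rw [show (M.updateCol p d).updateCol q b =
    ((M.updateCol p b).updateCol q d).submatrix id (Equiv.swap p q) from ?_, h]
  · simp
  · ext i j
    simp only [submatrix_apply, id, updateCol_apply, Equiv.swap_apply_def]
    split_ifs <;> simp_all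

/-- The three-term Plücker relation. -/
theorem detTwoCol_plucker (hpq : p ≠ q) (b c d z : ι → ℂ) :
    detTwoCol M p q c d * detTwoCol M p q b z =
      detTwoCol M p q b d * detTwoCol M p q c z + detTwoCol M p q c b * detTwoCol M p q d z := by
  set N := (M.updateCol p c).updateCol q d with hN
  have hsum : N.det • b = ∑ j, cramer N b j • N.col j := by
    rw [← mulVec_cramer]
    ext i
    simp [mulVec, dotProduct, mul_comm]
  obtain ⟨f, hf⟩ := exists_linearMap_eq_detTwoCol M (p := p) (q := q) z
  have h := congrArg f hsum
  simp only [map_smul, map_sum, smul_eq_mul] at h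
  simp only [hf] at h
  rw [Fintype.sum_eq_add p q hpq] at h
  · have h1 : cramer N b p = detTwoCol M p q b d := by
      rw [cramer_apply, detTwoCol, hN, updateCol_comm _ hpq.symm, updateCol_idem]
    have h2 : cramer N b q = detTwoCol M p q c b := by
      rw [cramer_apply, detTwoCol, hN, updateCol_idem]
    have h3 : N.col p = c := by ext i; simp [hN, hpq]
    have h4 : N.col q = d := by ext i; simp [hN]
    have h5 : N.det = detTwoCol M p q c d := rfl
    rw [h1, h2, h3, h4, h5, detTwoCol_swap M hpq b z, detTwoCol_swap M hpq c z,
      detTwoCol_swap M hpq d z] at h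
    linear_combination -h
  · rintro j ⟨hjp, hjq⟩
    have : N.col j = M.col j := by ext i; simp [hN, hjp, hjq]
    rw [this, detTwoCol_col_right M hjp hjq, mul_zero]

end detTwoCol

theorem SmatE_mul_self (n : ℕ) : SmatE n * SmatE n = 1 := by
  ext i j
  simp only [SmatE, mul_apply, of_apply, ite_mul, one_mul, zero_mul, Finset.sum_ite_eq',
    Finset.mem_univ, if_true, Fin.rev_rev, one_apply, eq_comm]

theorem mul_SmatE_mul_transpose {n : ℕ} {X : Matrix (Fin (2*n)) (Fin (2*n)) ℂ}
    (hX : X ∈ Oeven n) : X * SmatE n * Xᵀ = SmatE n := by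
  have h : SmatE n * Xᵀ * SmatE n * X = 1 := by
    have h0 : Xᵀ * SmatE n * X = SmatE n := hX
    rw [← SmatE_mul_self n]
    nth_rewrite 4 [← h0]
    simp only [Matrix.mul_assoc]
  have h' := mul_eq_one_comm.mp h
  calc X * SmatE n * Xᵀ = X * (SmatE n * Xᵀ * SmatE n) * SmatE n := by
        simp only [Matrix.mul_assoc, SmatE_mul_self, Matrix.mul_one]
    _ = SmatE n := by rw [h', Matrix.one_mul]

/-- The column `c` of `X`, restricted to the top `n` rows. -/
def topCol {n : ℕ} (X : Matrix (Fin (2*n)) (Fin (2*n)) ℂ) (c : Fin (2*n)) : Fin n → ℂ :=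
  fun i => X ⟨i, by omega⟩ c

/-- The span of the top `n` rows of an orthogonal matrix is isotropic. -/
theorem sum_topCol_mul_topCol_rev {n : ℕ} {X : Matrix (Fin (2*n)) (Fin (2*n)) ℂ}
    (hX : X ∈ Oeven n) (f g : (Fin n → ℂ) →ₗ[ℂ] ℂ) :
    ∑ c, f (topCol X c) * g (topCol X c.rev) = 0 := by
  have key (i j : Fin n) : ∑ c, topCol X c i * topCol X c.rev j = 0 := by
    have h := congrFun₂ (mul_SmatE_mul_transpose hX) ⟨i, by omega⟩ ⟨j, by omega⟩
    rw [Matrix.mul_assoc, mul_apply] at h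
    simp only [SmatE, mul_apply, of_apply, transpose_apply, ite_mul, one_mul, zero_mul,
      Finset.sum_ite_eq', Finset.mem_univ, if_true] at h
    refine h.trans (if_neg fun hij => ?_)
    have := congrArg Fin.val hij
    simp only [Fin.val_rev] at this
    omega
  let u (i : Fin n) := f fun k => if i = k then 1 else 0
  let v (j : Fin n) := g fun k => if j = k then 1 else 0
  simp only [LinearMap.pi_apply_eq_sum_univ f (topCol X _),
    LinearMap.pi_apply_eq_sum_univ g (topCol X _), Finset.sum_mul_sum, smul_eq_mul]
  rw [Finset.sum_comm]
  refine Finset.sum_eq_zero fun i _ => ?_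
  rw [Finset.sum_comm]
  refine Finset.sum_eq_zero fun j _ => ?_
  calc _ = ∑ c, topCol X c i * topCol X c.rev j * (u i * v j) :=
        Finset.sum_congr rfl fun c _ => mul_mul_mul_comm _ _ _ _
    _ = 0 := by rw [← Finset.sum_mul, key, zero_mul]

theorem middle_four_isotropic {m : ℕ} {X : Matrix (Fin (2*(m+2))) (Fin (2*(m+2))) ℂ}
    (hX : X ∈ Oeven (m+2)) (f g : (Fin (m+2) → ℂ) →ₗ[ℂ] ℂ)
    (hf : ∀ c : Fin (2*(m+2)), (c : ℕ) < m → f (topCol X c) = 0)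
    (hg : ∀ c : Fin (2*(m+2)), (c : ℕ) < m → g (topCol X c) = 0) :
    f (topCol X ⟨m, by omega⟩) * g (topCol X ⟨m+3, by omega⟩)
      + f (topCol X ⟨m+1, by omega⟩) * g (topCol X ⟨m+2, by omega⟩)
      + f (topCol X ⟨m+2, by omega⟩) * g (topCol X ⟨m+1, by omega⟩)
      + f (topCol X ⟨m+3, by omega⟩) * g (topCol X ⟨m, by omega⟩) = 0 := by
  have h := sum_topCol_mul_topCol_rev hX f g
  rw [← Finset.sum_subset (Finset.subset_univ
    {(⟨m, by omega⟩ : Fin (2*(m+2))), ⟨m+1, by omega⟩, ⟨m+2, by omega⟩, ⟨m+3, by omega⟩})] at h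
  · have r0 : Fin.rev (⟨m, by omega⟩ : Fin (2*(m+2))) = ⟨m+3, by omega⟩ := by
      ext; simp only [Fin.val_rev]; omega
    have r1 : Fin.rev (⟨m+1, by omega⟩ : Fin (2*(m+2))) = ⟨m+2, by omega⟩ := by
      ext; simp only [Fin.val_rev]; omega
    have r2 : Fin.rev (⟨m+2, by omega⟩ : Fin (2*(m+2))) = ⟨m+1, by omega⟩ := by
      ext; simp only [Fin.val_rev]; omega
    have r3 : Fin.rev (⟨m+3, by omega⟩ : Fin (2*(m+2))) = ⟨m, by omega⟩ := by
      ext; simp only [Fin.val_rev]; omega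
    rw [Finset.sum_insert (by simp), Finset.sum_insert (by simp), Finset.sum_insert (by simp),
      Finset.sum_singleton, r0, r1, r2, r3] at h
    linear_combination h
  · intro c _ hc
    simp only [Finset.mem_insert, Finset.mem_singleton, Fin.ext_iff, not_or] at hc
    rcases lt_or_ge (c : ℕ) m with hcm | hcm
    · rw [hf c hcm, zero_mul]
    · rw [hg c.rev (by rw [Fin.val_rev]; omega), mul_zero]

theorem det_eq_detTwoCol_single_last {m : ℕ} (M : Matrix (Fin (m+2)) (Fin (m+2)) ℂ)
    (b : Fin (m+2) → ℂ) :
    ((M.updateCol (Fin.last m).castSucc b).submatrix Fin.castSucc Fin.castSucc).det =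
      detTwoCol M (Fin.last m).castSucc (Fin.last (m+1)) b (Pi.single (Fin.last (m+1)) 1) := by
  rw [detTwoCol, det_succ_column _ (Fin.last (m+1)), Finset.sum_eq_single (Fin.last (m+1))]
  · have hsign : (-1 : ℂ) ^ (m + 1 + (m + 1)) = 1 := Even.neg_one_pow ⟨_, rfl⟩
    simp only [Fin.val_last, hsign, updateCol_self, Pi.single_eq_same, one_mul,
      Fin.succAbove_last]
    congr 1
    ext i j
    simp [updateCol_apply, Fin.ext_iff, j.isLt.ne]
  · intro i _ hi
    simp [hi]
  · simp

/-- For `X ∈ SO(2n,ℂ)`: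
`a_{-n,…,-3,1,2}(X) · (a_{-n,…,-3,-2}(X))² = −(a_{-n,…,-3,1}(X))² · a_{-n,…,-3,-2,-1}(X)`.
Here `a_{-n,…,-3,1,2}` and `a_{-n,…,-3,-2,-1}` are `n × n` minors over the top
`n` rows with columns at positions `0,…,n-3, n, n+1` resp. `0,…,n-1`, and
`a_{-n,…,-3,-2}`, `a_{-n,…,-3,1}` are `(n-1) × (n-1)` minors over the top
`n-1` rows with columns at positions `0,…,n-2` resp. `0,…,n-3, n`. -/
theorem statement11 (n : ℕ) (hn : 2 ≤ n) (X : Matrix (Fin (2*n)) (Fin (2*n)) ℂ)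
    (hX : X ∈ SOeven n) :
    (X.submatrix (fun s : Fin n => (⟨(s : ℕ), by have := s.isLt; omega⟩ : Fin (2*n)))
        (fun s : Fin n =>
          if (s : ℕ) < n - 2 then (⟨(s : ℕ), by have := s.isLt; omega⟩ : Fin (2*n))
          else if (s : ℕ) = n - 2 then (⟨n, by omega⟩ : Fin (2*n))
          else ⟨n + 1, by omega⟩)).det
      * ((X.submatrix (fun s : Fin (n-1) => (⟨(s : ℕ), by have := s.isLt; omega⟩ : Fin (2*n)))
        (fun s : Fin (n-1) => (⟨(s : ℕ), by have := s.isLt; omega⟩ : Fin (2*n)))).det) ^ 2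
    = - (((X.submatrix (fun s : Fin (n-1) => (⟨(s : ℕ), by have := s.isLt; omega⟩ : Fin (2*n)))
        (fun s : Fin (n-1) =>
          if (s : ℕ) < n - 2 then (⟨(s : ℕ), by have := s.isLt; omega⟩ : Fin (2*n))
          else ⟨n, by omega⟩)).det) ^ 2
      * (X.submatrix (fun s : Fin n => (⟨(s : ℕ), by have := s.isLt; omega⟩ : Fin (2*n)))
        (fun s : Fin n => (⟨(s : ℕ), by have := s.isLt; omega⟩ : Fin (2*n)))).det) := by
  obtain ⟨m, rfl⟩ : ∃ m, n = m + 2 := ⟨n - 2, by omega⟩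
  obtain ⟨hO, -⟩ := hX
  set p : Fin (m+2) := (Fin.last m).castSucc with hp
  set q : Fin (m+2) := Fin.last (m+1) with hq
  have hpq : p ≠ q := by simp [hp, hq, Fin.ext_iff]
  let M : Matrix (Fin (m+2)) (Fin (m+2)) ℂ := of fun i j => topCol X ⟨j, by omega⟩ i
  let e : Fin (m+2) → ℂ := Pi.single q 1
  let D := detTwoCol M p q
  let x₁ := topCol X ⟨m, by omega⟩
  let x₂ := topCol X ⟨m+1, by omega⟩
  let x₃ := topCol X ⟨m+2, by omega⟩
  let x₄ := topCol X ⟨m+3, by omega⟩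
  have hzero (b : Fin (m+2) → ℂ) (c : Fin (2*(m+2))) (hc : (c : ℕ) < m) :
      D b (topCol X c) = 0 :=
    detTwoCol_col_right M (j := ⟨c, by omega⟩) (by simp [hp, Fin.ext_iff]; omega)
      (by simp [hq, Fin.ext_iff]; omega) b
  have iso (b b' : Fin (m+2) → ℂ) :
      D b x₁ * D b' x₄ + D b x₂ * D b' x₃ + D b x₃ * D b' x₂ + D b x₄ * D b' x₁ = 0 := by
    obtain ⟨f, hf⟩ := exists_linearMap_eq_detTwoCol M (p := p) (q := q) b
    obtain ⟨g, hg⟩ := exists_linearMap_eq_detTwoCol M (p := p) (q := q) b'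
    have h := middle_four_isotropic hO f g (fun c hc => (hf _).trans (hzero b c hc))
      (fun c hc => (hg _).trans (hzero b' c hc))
    simpa only [hf, hg] using h
  have hswap (b d : Fin (m+2) → ℂ) : D d b = -D b d := detTwoCol_swap M hpq b d
  have hself (b : Fin (m+2) → ℂ) : D b b = 0 := detTwoCol_self M hpq b
  have main : D x₃ x₄ * D x₁ e ^ 2 = -(D x₃ e ^ 2 * D x₁ x₂) := by
    have hpl : D x₃ x₄ * D x₁ e = D x₁ x₄ * D x₃ e + D x₃ x₁ * D x₄ e :=
      detTwoCol_plucker M hpq x₁ x₃ x₄ e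
    have hee := iso e e
    have h1 := iso e x₁
    rw [hswap e x₁, hswap e x₃, hswap e x₄, hswap x₁ x₃] at hpl
    rw [hself] at h1
    rw [hswap e x₁, hswap e x₃]
    linear_combination D e x₃ * h1 - D e x₁ * hpl - D x₁ x₃ / 2 * hee
  have e34 : (X.submatrix (fun s : Fin (m+2) => (⟨(s : ℕ), by omega⟩ : Fin (2*(m+2))))
      (fun s : Fin (m+2) =>
        if (s : ℕ) < m + 2 - 2 then (⟨(s : ℕ), by omega⟩ : Fin (2*(m+2)))
        else if (s : ℕ) = m + 2 - 2 then (⟨m + 2, by omega⟩ : Fin (2*(m+2)))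
        else ⟨m + 2 + 1, by omega⟩)).det = D x₃ x₄ := by
    simp only [D, detTwoCol]
    congr 1
    ext i j
    simp only [submatrix_apply, updateCol_apply, hp, hq, Fin.ext_iff, Fin.val_last,
      Fin.val_castSucc, M, x₃, x₄, topCol, of_apply]
    split_ifs <;> first | rfl | omega
  have e12 : (X.submatrix (fun s : Fin (m+2) => (⟨(s : ℕ), by omega⟩ : Fin (2*(m+2))))
      (fun s : Fin (m+2) => (⟨(s : ℕ), by omega⟩ : Fin (2*(m+2))))).det = D x₁ x₂ := by
    simp only [D, detTwoCol]
    congr 1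
    ext i j
    simp only [submatrix_apply, updateCol_apply, hp, hq, Fin.ext_iff, Fin.val_last,
      Fin.val_castSucc, M, x₁, x₂, topCol, of_apply]
    split_ifs <;> simp [*]
  have e1 : (X.submatrix (fun s : Fin (m+1) => (⟨(s : ℕ), by omega⟩ : Fin (2*(m+2))))
      (fun s : Fin (m+1) => (⟨(s : ℕ), by omega⟩ : Fin (2*(m+2))))).det = D x₁ e := by
    refine Eq.trans ?_ (det_eq_detTwoCol_single_last M x₁)
    congr 1
    ext i j
    simp only [submatrix_apply, updateCol_apply, Fin.ext_iff, Fin.val_last,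
      Fin.val_castSucc, M, x₁, topCol, of_apply]
    split_ifs <;> simp [*]
  have e3 : (X.submatrix (fun s : Fin (m+1) => (⟨(s : ℕ), by omega⟩ : Fin (2*(m+2))))
      (fun s : Fin (m+1) =>
        if (s : ℕ) < m + 2 - 2 then (⟨(s : ℕ), by omega⟩ : Fin (2*(m+2)))
        else ⟨m + 2, by omega⟩)).det = D x₃ e := by
    refine Eq.trans ?_ (det_eq_detTwoCol_single_last M x₃)
    congr 1
    ext i j
    simp only [submatrix_apply, updateCol_apply, Fin.ext_iff, Fin.val_last,
      Fin.val_castSucc, M, x₃, topCol, of_apply]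
    split_ifs <;> first | rfl | omega
  rw [← e34, ← e12, ← e1, ← e3] at main
  exact main
end
end

section
/- Let n ≥ 2. For every X ∈ SO(2n,ℂ) one has ā_{-n,…,-3,-2,2}(X) = −ā_{-n,…,-3,-1,1}(X); that is, the determinant of the n×n submatrix of X with rows -n,…,-2,1 (the first n−1 rows together with row 1) and columns -n,…,-3,-2,2 equals minus the determinant of the n×n submatrix with the same rows and columns -n,…,-3,-1,1. -/
open Matrix

noncomputable section

/-- Jacobi's identity for complementary minors, in block form. -/
theorem det_toBlocks₁₁_eq_of_mul_eq_one {l m R : Type*} [Fintype l] [Fintype m]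
    [DecidableEq l] [DecidableEq m] [CommRing R] {M N : Matrix (l ⊕ m) (l ⊕ m) R}
    (h : M * N = 1) : M.toBlocks₁₁.det = M.det * N.toBlocks₂₂.det := by
  have key : M * fromBlocks 1 N.toBlocks₁₂ 0 N.toBlocks₂₂ =
      fromBlocks M.toBlocks₁₁ 0 M.toBlocks₂₁ 1 := by
    rw [← fromBlocks_toBlocks M, ← fromBlocks_toBlocks N, fromBlocks_multiply,
      ← fromBlocks_one, fromBlocks_inj] at h
    conv_lhs => rw [← fromBlocks_toBlocks M]
    rw [fromBlocks_multiply]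
    simp [h.2.1, h.2.2.2]
  have hdet := congrArg det key
  rw [det_mul, det_fromBlocks_zero₂₁, det_fromBlocks_zero₁₂] at hdet
  simpa using hdet.symm

/-- The inverse of `X ∈ O(2n,ℂ)` is the reflection of `X` in the antidiagonal. -/
theorem mul_submatrix_rev_transpose_of_mem_Oeven {n : ℕ}
    {X : Matrix (Fin (2*n)) (Fin (2*n)) ℂ} (hX : X ∈ Oeven n) :
    X * Xᵀ.submatrix Fin.rev Fin.rev = 1 := by
  have hconj : SmatE n * Xᵀ * SmatE n = Xᵀ.submatrix Fin.rev Fin.rev := by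
    ext i j
    have hj (k : Fin (2*n)) : j = k.rev ↔ k = j.rev := by rw [← Fin.rev_eq_iff, eq_comm]
    simp [SmatE, Matrix.mul_apply, hj]
  have hX' : Xᵀ * SmatE n * X = SmatE n := hX
  rw [← hconj]
  apply mul_eq_one_comm.mp
  rw [Matrix.mul_assoc, Matrix.mul_assoc, ← Matrix.mul_assoc Xᵀ, hX', SmatE_mul_self]

/-- If `r` together with its reversal enumerates all of `Fin (2n)`, and a transposition `τ` of
the columns is applied, the corresponding complementary minors of `X ∈ SO(2n,ℂ)` are opposite. -/
theorem det_submatrix_swap_eq_neg {n : ℕ} {X : Matrix (Fin (2*n)) (Fin (2*n)) ℂ}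
    (hX : X ∈ SOeven n) {r c d : Fin n → Fin (2*n)}
    (hr : Function.Injective (Sum.elim r (Fin.rev ∘ r))) {a b : Fin (2*n)} (hab : a ≠ b)
    (hc : ∀ s, c s = Equiv.swap a b (r s))
    (hd : ∀ s, (d s).rev = Equiv.swap a b (r s).rev) :
    (X.submatrix r c).det = -(X.submatrix r d).det := by
  let e : Fin n ⊕ Fin n ≃ Fin (2*n) := Equiv.ofBijective _
    ((Fintype.bijective_iff_injective_and_card _).mpr ⟨hr, by simp [two_mul]⟩)
  let τ := Equiv.swap a b
  have hmul : (X.submatrix id τ).submatrix e e *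
      ((Xᵀ.submatrix Fin.rev Fin.rev).submatrix τ id).submatrix e e = 1 := by
    rw [submatrix_mul_equiv, submatrix_mul_equiv,
      mul_submatrix_rev_transpose_of_mem_Oeven hX.1]
    simp
  have hdet := det_toBlocks₁₁_eq_of_mul_eq_one hmul
  rw [det_submatrix_equiv_self, det_permute', Equiv.Perm.sign_swap hab, hX.2] at hdet
  have h₁ : ((X.submatrix id τ).submatrix e e).toBlocks₁₁ = X.submatrix r c := by
    ext i j
    simp [toBlocks₁₁, e, τ, hc]
  have h₂ : (((Xᵀ.submatrix Fin.rev Fin.rev).submatrix τ id).submatrix e e).toBlocks₂₂ =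
      (X.submatrix r d)ᵀ := by
    ext i j
    simp [toBlocks₂₂, e, τ, ← hd]
  rw [h₁, h₂, det_transpose] at hdet
  simpa using hdet

/-- For `X ∈ SO(2n,ℂ)`: `ā_{-n,…,-3,-2,2}(X) = − ā_{-n,…,-3,-1,1}(X)`, both
`n × n` minors over rows `-n,…,-2,1` (positions `0,…,n-2` and `n`), with
columns `-n,…,-3,-2,2` (positions `0,…,n-2`, `n+1`) resp. columns
`-n,…,-3,-1,1` (positions `0,…,n-3`, `n-1`, `n`). -/
theorem statement13 (n : ℕ) (hn : 2 ≤ n) (X : Matrix (Fin (2*n)) (Fin (2*n)) ℂ)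
    (hX : X ∈ SOeven n) :
    (X.submatrix
        (fun s : Fin n =>
          if (s : ℕ) < n - 1 then (⟨(s : ℕ), by have := s.isLt; omega⟩ : Fin (2*n))
          else ⟨n, by omega⟩)
        (fun s : Fin n =>
          if (s : ℕ) < n - 1 then (⟨(s : ℕ), by have := s.isLt; omega⟩ : Fin (2*n))
          else ⟨n + 1, by omega⟩)).det
    = - (X.submatrix
        (fun s : Fin n =>
          if (s : ℕ) < n - 1 then (⟨(s : ℕ), by have := s.isLt; omega⟩ : Fin (2*n))
          else ⟨n, by omega⟩)
        (fun s : Fin n =>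
          if (s : ℕ) < n - 2 then (⟨(s : ℕ), by have := s.isLt; omega⟩ : Fin (2*n))
          else if (s : ℕ) = n - 2 then (⟨n - 1, by omega⟩ : Fin (2*n))
          else ⟨n, by omega⟩)).det := by
  refine det_submatrix_swap_eq_neg hX (a := ⟨n, by omega⟩) (b := ⟨n + 1, by omega⟩)
    ?_ (by simp) ?_ ?_
  · rintro (s | s) (t | t) h <;> have := s.isLt <;> have := t.isLt <;>
      simp only [Sum.elim_inl, Sum.elim_inr, Function.comp_apply] at h <;>
      split_ifs at h <;>
      simp only [Fin.ext_iff, Fin.val_rev, Sum.inl.injEq, Sum.inr.injEq, reduceCtorEq] at h ⊢ <;>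
      omega
  · intro s
    have := s.isLt
    rw [Equiv.swap_apply_def]
    by_cases hs : (s : ℕ) < n - 1 <;> simp only [hs, if_true, if_false]
    all_goals split_ifs <;> simp only [Fin.ext_iff] at * <;> omega
  · intro s
    have := s.isLt
    rw [Equiv.swap_apply_def]
    split_ifs <;> simp only [Fin.ext_iff, Fin.val_rev] at * <;> omega
end
end
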